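/- arXiv:2001.05589 — 2 statements merged into one kernel-verified Lean document; each statement's English description precedes it below -/
import Mathlib

section
/- The proportion, among all n! permutations π of [n], of those containing a pair of twins of length ⌈2e·n^{2/3}⌉ tends to 0 as n → ∞. (That is, a uniformly random n-permutation asymptotically almost surely satisfies t(π) = O(n^{2/3}).) -/
/-- `f` and `g` enumerate (in increasing order of positions) a pair of twins in the
permutation `π`: both are strictly monotone position sequences, with disjoint ranges,
and the two subsequences of `π` are order-isomorphic. -/
def IsTwinPair {n : ℕ} (π : Equiv.Perm (Fin n)) {k : ℕ} (f g : Fin k → Fin n) : Prop :=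
  StrictMono f ∧ StrictMono g ∧ (∀ a b : Fin k, f a ≠ g b) ∧
    (∀ a b : Fin k, π (f a) < π (f b) ↔ π (g a) < π (g b))

/-- `π` contains a pair of twins of length `k`. -/
def HasTwins {n : ℕ} (π : Equiv.Perm (Fin n)) (k : ℕ) : Prop :=
  ∃ f g : Fin k → Fin n, IsTwinPair π f g

/-- `t(π)`: the maximum length of a pair of twins in `π`. -/
noncomputable def twinLen {n : ℕ} (π : Equiv.Perm (Fin n)) : ℕ :=
  sSup {k | HasTwins π k}

/-- The range of `f` is a block (a set of consecutive positions). -/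
def IsBlockFun {n k : ℕ} (f : Fin k → Fin n) : Prop :=
  ∃ s : ℕ, ∀ a : Fin k, (f a : ℕ) = s + (a : ℕ)

/-- `π` contains a pair of block twins of length `k`. -/
def HasBlockTwins {n : ℕ} (π : Equiv.Perm (Fin n)) (k : ℕ) : Prop :=
  ∃ f g : Fin k → Fin n, IsTwinPair π f g ∧ IsBlockFun f ∧ IsBlockFun g

/-- The union of the ranges of `f` and `g` is a block (a set of `2k` consecutive positions). -/
def IsTightPair {n k : ℕ} (f g : Fin k → Fin n) : Prop :=
  ∃ s : ℕ, ∀ x : Fin n,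
    ((∃ a, f a = x) ∨ (∃ a, g a = x)) ↔ (s ≤ (x : ℕ) ∧ (x : ℕ) < s + 2 * k)

/-- `π` contains a pair of tight twins of length `k`. -/
def HasTightTwins {n : ℕ} (π : Equiv.Perm (Fin n)) (k : ℕ) : Prop :=
  ∃ f g : Fin k → Fin n, IsTwinPair π f g ∧ IsTightPair f g

/-- Two injections into a well-founded linear order that differ by a permutation and
induce the same order pattern coincide. -/
theorem perm_eq_one_of_lt_iff_lt {α β : Type*} [LinearOrder β] [WellFoundedLT β]
    {h : α → β} (hinj : Function.Injective h) (τ : Equiv.Perm α)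
    (hτ : ∀ a b, h (τ a) < h (τ b) ↔ h a < h b) : τ = 1 := by
  let r : α → α → Prop := fun a b => h a < h b
  have hr : IsWellOrder α r :=
    RelEmbedding.isWellOrder (s := (· < ·)) ⟨⟨h, hinj⟩, Iff.rfl⟩
  let e : r ≃r r := ⟨τ, hτ _ _⟩
  ext a
  exact e.toInitialSeg.eq (InitialSeg.refl r) a

/-- For fixed disjoint positions, at most a `1 / k!` fraction of permutations has
order-isomorphic subsequences there. -/
theorem card_isTwinPair_mul_factorial_le {n k : ℕ} (f g : Fin k → Fin n) :
    Nat.card {π : Equiv.Perm (Fin n) // IsTwinPair π f g} * k.factorial ≤ n.factorial := by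
  classical
  by_cases hg : StrictMono g ∧ ∀ a b : Fin k, f a ≠ g b
  swap
  · have : IsEmpty {π : Equiv.Perm (Fin n) // IsTwinPair π f g} :=
      ⟨fun π => hg ⟨π.2.2.1, π.2.2.2.1⟩⟩
    simp
  obtain ⟨hg, hdisj⟩ := hg
  let ι : Fin k ↪ Fin n := ⟨g, hg.injective⟩
  let F : {π : Equiv.Perm (Fin n) // IsTwinPair π f g} × Equiv.Perm (Fin k) →
      Equiv.Perm (Fin n) := fun p => p.1.1 * p.2.viaFintypeEmbedding ι
  have hFf (p) (a : Fin k) : F p (f a) = p.1.1 (f a) := by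
    have : f a ∉ Set.range ι := by
      rintro ⟨b, hb⟩
      exact hdisj a b hb.symm
    simp only [F, Equiv.Perm.mul_apply,
      Equiv.Perm.viaFintypeEmbedding_apply_notMem_range _ _ this]
  have hFg (p) (a : Fin k) : F p (g a) = p.1.1 (g (p.2 a)) :=
    congrArg p.1.1 (Equiv.Perm.viaFintypeEmbedding_apply_image p.2 ι a)
  have hF : Function.Injective F := by
    rintro ⟨⟨π, hπ⟩, σ⟩ ⟨⟨π', hπ'⟩, σ'⟩ h
    have hf (a) : π (f a) = π' (f a) := by
      have := hFf ⟨⟨π, hπ⟩, σ⟩ a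
      rw [h, hFf] at this
      exact this.symm
    have hgs (a) : π (g (σ a)) = π' (g (σ' a)) := by
      have := hFg ⟨⟨π, hπ⟩, σ⟩ a
      rw [h, hFg] at this
      exact this.symm
    have hτ : σ' * σ⁻¹ = 1 := by
      have key (a) : π' (g ((σ' * σ⁻¹) a)) = π (g a) := by
        simp [← hgs]
      refine perm_eq_one_of_lt_iff_lt (h := fun a => π' (g a))
        (π'.injective.comp hg.injective) _ fun a b => ?_
      rw [key, key, ← hπ.2.2.2, ← hπ'.2.2.2, hf, hf]
    obtain rfl : σ' = σ := mul_inv_eq_one.mp hτ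
    obtain rfl : π = π' := mul_right_cancel (show π * _ = π' * _ from h)
    rfl
  have := Nat.card_le_card_of_injective F hF
  simpa [Nat.card_prod, Nat.card_eq_fintype_card, Fintype.card_perm] using this

theorem card_strictMono_le_choose (n k : ℕ) :
    Nat.card {f : Fin k → Fin n // StrictMono f} ≤ n.choose k := by
  classical
  let F : {f : Fin k → Fin n // StrictMono f} →
      (Finset.univ : Finset (Fin n)).powersetCard k := fun f =>
    ⟨Finset.univ.image f.1, by
      simp [Finset.mem_powersetCard, Finset.card_image_of_injective _ f.2.injective]⟩
  have hF : Function.Injective F := by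
    rintro ⟨f, hf⟩ ⟨g, hg⟩ h
    have h' : Finset.univ.image f = Finset.univ.image g := congrArg Subtype.val h
    have : Set.range f = Set.range g := by
      simpa using congrArg (fun s : Finset (Fin n) => (s : Set (Fin n))) h'
    exact Subtype.ext ((hf.range_inj hg).mp this)
  simpa using Nat.card_le_card_of_injective F hF

/-- The first-moment bound for the number of permutations containing twins of length `k`. -/
theorem card_hasTwins_mul_factorial_le (n k : ℕ) :
    Nat.card {π : Equiv.Perm (Fin n) // HasTwins π k} * k.factorial
      ≤ n.choose k ^ 2 * n.factorial := by
  classical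
  let S := {f : Fin k → Fin n // StrictMono f}
  let F : {π : Equiv.Perm (Fin n) // HasTwins π k} →
      Σ p : S × S, {π : Equiv.Perm (Fin n) // IsTwinPair π p.1.1 p.2.1} := fun π =>
    ⟨(⟨π.2.choose, π.2.choose_spec.choose_spec.1⟩,
      ⟨π.2.choose_spec.choose, π.2.choose_spec.choose_spec.2.1⟩),
      π.1, π.2.choose_spec.choose_spec⟩
  have hF : Function.Injective F := fun π π' h =>
    Subtype.ext (congrArg (fun x : Σ p : S × S,
      {π : Equiv.Perm (Fin n) // IsTwinPair π p.1.1 p.2.1} => x.2.1) h)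
  calc
    _ ≤ (∑ p : S × S, Nat.card {π : Equiv.Perm (Fin n) // IsTwinPair π p.1.1 p.2.1})
          * k.factorial := by
      gcongr
      rw [← Nat.card_sigma]
      exact Nat.card_le_card_of_injective F hF
    _ ≤ ∑ _p : S × S, n.factorial := by
      rw [Finset.sum_mul]
      exact Finset.sum_le_sum fun p _ => card_isTwinPair_mul_factorial_le _ _
    _ = Nat.card S ^ 2 * n.factorial := by
      simp [Nat.card_eq_fintype_card, sq]
    _ ≤ _ := by
      gcongr
      exact card_strictMono_le_choose n k

theorem card_hasTwins_div_factorial_le_pow {n k : ℕ} (hk : 0 < k) :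
    (Nat.card {π : Equiv.Perm (Fin n) // HasTwins π k} : ℝ) / n.factorial
      ≤ (Real.exp 1 ^ 3 * (n : ℝ) ^ 2 / (k : ℝ) ^ 3) ^ k := by
  have hnf : (0 : ℝ) < n.factorial := by positivity
  have hkf : (0 : ℝ) < k.factorial := by positivity
  have hk' : (0 : ℝ) < k := by positivity
  have hmain : (Nat.card {π : Equiv.Perm (Fin n) // HasTwins π k} : ℝ) * k.factorial
      ≤ (n.choose k : ℝ) ^ 2 * n.factorial := by
    exact_mod_cast card_hasTwins_mul_factorial_le n k
  have hchoose : (n.choose k : ℝ) ≤ (n : ℝ) ^ k / k.factorial := Nat.choose_le_pow_div k n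
  have hfac : 1 / (k.factorial : ℝ) ≤ (Real.exp 1 / k) ^ k := by
    have := Real.pow_div_factorial_le_exp (k : ℝ) hk'.le k
    rw [div_pow, ← Real.exp_nat_mul, mul_one, le_div_iff₀ (by positivity)]
    calc _ = (k : ℝ) ^ k / k.factorial := by ring
      _ ≤ _ := this
  calc
    _ ≤ (n.choose k : ℝ) ^ 2 / k.factorial := by
      rwa [div_le_div_iff₀ hnf hkf]
    _ ≤ ((n : ℝ) ^ k / k.factorial) ^ 2 / k.factorial := by gcongr
    _ = ((n : ℝ) ^ k) ^ 2 * (1 / (k.factorial : ℝ)) ^ 3 := by field_simp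
    _ ≤ ((n : ℝ) ^ k) ^ 2 * ((Real.exp 1 / k) ^ k) ^ 3 := by gcongr
    _ = _ := by
      simp only [div_pow, mul_pow, ← pow_mul]
      rw [mul_comm k 2, mul_comm k 3]
      ring

/-- The proportion of $n$-permutations containing a pair of twins of length
$⌈2e·n^{2/3}⌉$ tends to $0$: a.a.s. $t(π) = O(n^{2/3})$. -/
theorem random_twins_upper :
    Filter.Tendsto (fun n : ℕ =>
        (Nat.card {π : Equiv.Perm (Fin n) //
            HasTwins π ⌈2 * Real.exp 1 * (n : ℝ) ^ ((2 : ℝ) / 3)⌉₊} : ℝ)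
          / (Nat.factorial n : ℝ))
      Filter.atTop (nhds 0) := by
  have hbase : Filter.Tendsto (fun n : ℕ => 2 * Real.exp 1 * (n : ℝ) ^ ((2 : ℝ) / 3))
      Filter.atTop Filter.atTop :=
    ((tendsto_rpow_atTop (by norm_num)).comp tendsto_natCast_atTop_atTop).const_mul_atTop
      (by positivity)
  have hpow : Filter.Tendsto
      (fun n : ℕ => (1 / 8 : ℝ) ^ ⌈2 * Real.exp 1 * (n : ℝ) ^ ((2 : ℝ) / 3)⌉₊)
      Filter.atTop (nhds 0) :=
    (tendsto_pow_atTop_nhds_zero_of_lt_one (by norm_num) (by norm_num)).comp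
      (tendsto_nat_ceil_atTop.comp hbase)
  refine squeeze_zero' (Filter.Eventually.of_forall fun n => by positivity) ?_ hpow
  filter_upwards [Filter.eventually_gt_atTop 0] with n hn
  have hn' : (0 : ℝ) < n := by positivity
  have hx : 0 < 2 * Real.exp 1 * (n : ℝ) ^ ((2 : ℝ) / 3) := by positivity
  have hk := Nat.ceil_pos.mpr hx
  refine (card_hasTwins_div_factorial_le_pow hk).trans ?_
  refine pow_le_pow_left₀ (by positivity) ?_ _
  have hcube : (2 * Real.exp 1 * (n : ℝ) ^ ((2 : ℝ) / 3)) ^ 3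
      = 8 * (Real.exp 1 ^ 3 * (n : ℝ) ^ 2) := by
    have : ((n : ℝ) ^ ((2 : ℝ) / 3)) ^ 3 = (n : ℝ) ^ 2 := by
      rw [← Real.rpow_natCast, ← Real.rpow_mul hn'.le, ← Real.rpow_natCast]
      norm_num
    rw [mul_pow, this]
    ring
  have hle := pow_le_pow_left₀ hx.le (Nat.le_ceil _) 3
  rw [hcube] at hle
  rw [div_le_iff₀ (by positivity)]
  linarith
end

section
/- There exists a constant c > 0 such that the proportion, among all n! permutations π of [n], of those satisfying t(π) ≥ c·n^{2/3} tends to 1 as n → ∞. Combined with the a.a.s. upper bound, a uniformly random n-permutation asymptotically almost surely satisfies t(π) = Θ(n^{2/3}). -/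
section

open Finset

theorem HasTwins.le_card {n k : ℕ} {π : Equiv.Perm (Fin n)} (h : HasTwins π k) : k ≤ n := by
  obtain ⟨f, -, hf, -⟩ := h
  simpa using Fintype.card_le_of_injective f hf.injective

theorem HasTwins.le_twinLen {n k : ℕ} {π : Equiv.Perm (Fin n)} (h : HasTwins π k) :
    k ≤ twinLen π :=
  le_csSup ⟨n, fun _ hj => HasTwins.le_card hj⟩ h

/-- The `j`-th position of the `t`-th block, where the first `T * L` of `T * L + d` positions are
divided into `T` consecutive blocks of length `L`. -/
def blockPos {T L : ℕ} (d : ℕ) (t : Fin T) (j : Fin L) : Fin (T * L + d) :=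
  Fin.castAdd d (finProdFinEquiv (t, j))

theorem blockPos_lt_of_lt {T L d : ℕ} {t u : Fin T} (h : t < u) (i j : Fin L) :
    blockPos d t i < blockPos d u j := by
  rw [Fin.lt_def] at h ⊢
  simp only [blockPos, Fin.val_castAdd, finProdFinEquiv_apply_val]
  have := i.isLt
  have : L * (t + 1) ≤ L * (u : ℕ) := Nat.mul_le_mul_left _ h
  rw [mul_add] at this
  omega

theorem blockPos_inj {T L d : ℕ} {t u : Fin T} {i j : Fin L}
    (h : blockPos d t i = blockPos d u j) : t = u ∧ i = j := by
  have := finProdFinEquiv.injective (Fin.castAdd_injective _ _ h)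
  simpa using this

/-- `R` contains a matching of size `k`. -/
def HasMatching {T m : ℕ} (R : Fin T → Fin m → Prop) (k : ℕ) : Prop :=
  ∃ (c : Fin k → Fin T) (r : Fin k → Fin m), StrictMono c ∧ Function.Injective r ∧
    ∀ a, R (c a) (r a)

theorem hasMatching_of_finset {T m : ℕ} {R : Fin T → Fin m → Prop} {s : Finset (Fin T × Fin m)}
    (h1 : Set.InjOn Prod.fst (s : Set (Fin T × Fin m)))
    (h2 : Set.InjOn Prod.snd (s : Set (Fin T × Fin m)))
    (hR : ∀ p ∈ s, R p.1 p.2) : HasMatching R #s := by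
  have hc : #(s.image Prod.fst) = #s := card_image_of_injOn h1
  have key : ∀ a : Fin #s, ∃ r, ((s.image Prod.fst).orderEmbOfFin hc a, r) ∈ s := by
    intro a
    obtain ⟨p, hp, hpa⟩ := mem_image.1 (orderEmbOfFin_mem (s.image Prod.fst) hc a)
    exact ⟨p.2, by rw [← hpa]; exact hp⟩
  choose r hr using key
  refine ⟨(s.image Prod.fst).orderEmbOfFin hc, r, OrderEmbedding.strictMono _, ?_,
    fun a => hR _ (hr a)⟩
  intro a b hab
  have := h2 (hr a) (hr b) hab
  exact (RelEmbedding.injective _) (congrArg Prod.fst this)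

/-- A relation without a matching of size `k` is covered by at most `k` rows and at most `k`
columns. -/
theorem exists_cover_of_not_hasMatching {T m k : ℕ} {R : Fin T → Fin m → Prop}
    (h : ¬ HasMatching R k) :
    ∃ (A : Finset (Fin T)) (B : Finset (Fin m)), #A ≤ k ∧ #B ≤ k ∧
      ∀ t ∉ A, ∀ r, R t r → r ∈ B := by
  by_contra! hcov
  have key : ∀ j ≤ k, ∃ s : Finset (Fin T × Fin m), #s = j ∧
      Set.InjOn Prod.fst (s : Set (Fin T × Fin m)) ∧
      Set.InjOn Prod.snd (s : Set (Fin T × Fin m)) ∧ ∀ p ∈ s, R p.1 p.2 := by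
    intro j
    induction j with
    | zero => exact fun _ => ⟨∅, by simp⟩
    | succ j ih =>
      intro hj
      obtain ⟨s, hs, h1, h2, hR⟩ := ih (by omega)
      obtain ⟨t, ht, r, hr, hrB⟩ := hcov (s.image Prod.fst) (s.image Prod.snd)
        (card_image_le.trans (by omega)) (card_image_le.trans (by omega))
      have hmem : (t, r) ∉ s := fun hm => ht (mem_image_of_mem Prod.fst hm)
      refine ⟨insert (t, r) s, by rw [card_insert_of_notMem hmem, hs], ?_, ?_, ?_⟩
      · rw [coe_insert, Set.injOn_insert (by exact_mod_cast hmem)]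
        exact ⟨h1, by simpa using ht⟩
      · rw [coe_insert, Set.injOn_insert (by exact_mod_cast hmem)]
        exact ⟨h2, by simpa using hrB⟩
      · intro p hp
        rcases mem_insert.1 hp with rfl | hp
        exacts [hr, hR p hp]
  obtain ⟨s, hs, h1, h2, hR⟩ := key k le_rfl
  exact h (hs ▸ hasMatching_of_finset h1 h2 hR)

/-- In the labelling `h`, the label `r` occurs at least twice in the block `t`. -/
def RepeatsInBlock {T L d m : ℕ} (h : Fin (T * L + d) → Fin m) (t : Fin T) (r : Fin m) : Prop :=
  ∃ i j : Fin L, i ≠ j ∧ h (blockPos d t i) = r ∧ h (blockPos d t j) = r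

theorem hasTwins_of_hasMatching {T L d m k : ℕ} {π : Equiv.Perm (Fin (T * L + d))}
    {w : Fin (T * L + d) → Fin m} (hw : Monotone w)
    (h : HasMatching (RepeatsInBlock (T := T) (L := L) (w ∘ π)) k) : HasTwins π k := by
  obtain ⟨c, r, hc, hr, hR⟩ := h
  choose i j hij hi hj using hR
  have key : ∀ {x y}, w (π x) ≠ w (π y) → (π x < π y ↔ w (π x) < w (π y)) := fun hne =>
    ⟨fun hlt => lt_of_le_of_ne (hw hlt.le) hne, fun hlt => hw.reflect_lt hlt⟩
  simp only [Function.comp_apply] at hi hj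
  refine ⟨fun a => blockPos d (c a) (i a), fun a => blockPos d (c a) (j a),
    fun a b hab => blockPos_lt_of_lt (hc hab) _ _, fun a b hab => blockPos_lt_of_lt (hc hab) _ _,
    fun a b hab => ?_, fun a b => ?_⟩
  · obtain ⟨h1, h2⟩ := blockPos_inj hab
    obtain rfl := hc.injective h1
    exact hij a h2
  · by_cases hab : a = b
    · simp [hab]
    · have hne := hr.ne hab
      rw [key (by rwa [hi, hi]), key (by rwa [hj, hj]), hi, hi, hj, hj]

/-- Comparison of a random permutation with a random labelling by independent uniform labels. -/
theorem card_perm_mul_descFactorial_le {n m M : ℕ} (P : Equiv.Perm (Fin n) → Prop)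
    (Q : (Fin n → Fin m) → Prop) [DecidablePred P] [DecidablePred Q]
    (hPQ : ∀ π, P π → ∀ w : Fin n → Fin m, Monotone w → Q (w ∘ π)) :
    #{π | P π} * (m * M).descFactorial n ≤ n.factorial * (#{h | Q h} * M ^ n) := by
  have key : Fintype.card ({π // P π} × {S : Finset (Fin m ×ₗ Fin M) // #S = n}) ≤
      Fintype.card ({h // Q h} × (Fin n → Fin M)) := by
    refine Fintype.card_le_of_injective (fun x =>
      (⟨fun i => (ofLex (x.2.val.orderEmbOfFin x.2.property (x.1.1 i))).1, hPQ x.1.1 x.1.2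
          (fun i => (ofLex (x.2.val.orderEmbOfFin x.2.property i)).1)
          (Prod.Lex.monotone_fst_ofLex.comp (OrderEmbedding.monotone _))⟩,
        fun i => (ofLex (x.2.val.orderEmbOfFin x.2.property (x.1.1 i))).2)) ?_
    rintro ⟨⟨π, hπ⟩, S, hS⟩ ⟨⟨σ, hσ⟩, S', hS'⟩ hx
    simp only [Prod.mk.injEq, Subtype.mk.injEq] at hx
    have hg : S.orderEmbOfFin hS ∘ π = S'.orderEmbOfFin hS' ∘ σ := by
      funext i
      exact ofLex.injective (Prod.ext (congrFun hx.1 i) (congrFun hx.2 i))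
    have hSS : S = S' := by
      have := congrArg Set.range hg
      rw [π.surjective.range_comp, σ.surjective.range_comp] at this
      simpa using this
    subst hSS
    have : π = σ := Equiv.ext fun i => (S.orderEmbOfFin hS).injective (congrFun hg i)
    subst this
    rfl
  have hlex : Fintype.card (Fin m ×ₗ Fin M) = m * M := by
    rw [Fintype.card_lex, Fintype.card_prod, Fintype.card_fin, Fintype.card_fin]
  rw [Fintype.card_prod, Fintype.card_prod, Fintype.card_finset_len, hlex, Fintype.card_subtype,
    Fintype.card_subtype] at key
  rw [Nat.descFactorial_eq_factorial_mul_choose, mul_left_comm]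
  refine Nat.mul_le_mul_left _ (key.trans_eq ?_)
  simp

theorem pow_le_two_mul_descFactorial {N n : ℕ} (h : 2 * n ^ 2 ≤ N) :
    (N : ℝ) ^ n ≤ 2 * N.descFactorial n := by
  rcases Nat.eq_zero_or_pos n with rfl | hn
  · simp
  have hnN : n ≤ N := by nlinarith
  have hN : (0 : ℝ) < N := by exact_mod_cast (by omega : 0 < N)
  have h1 : ((N : ℝ) - n) ^ n ≤ N.descFactorial n := by
    have := (Nat.pow_le_pow_left (by omega : N - n ≤ N + 1 - n) n).trans
      (Nat.pow_sub_le_descFactorial N n)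
    rw [← Nat.cast_sub hnN]
    exact_mod_cast this
  have h2 : 1 + (n : ℝ) * (-(n / N)) ≤ (1 + -(n / N)) ^ n := by
    apply one_add_mul_le_pow
    have : (n : ℝ) / N ≤ 1 := (div_le_one hN).2 (by exact_mod_cast hnN)
    linarith
  have h3 : (n : ℝ) * (n / N) ≤ 1 / 2 := by
    rw [mul_div_assoc', div_le_div_iff₀ hN two_pos]
    have : (2 * n ^ 2 : ℝ) ≤ N := by exact_mod_cast h
    nlinarith
  have h4 : ((N : ℝ) - n) ^ n = N ^ n * (1 + -(n / N)) ^ n := by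
    rw [← mul_pow]
    congr 1
    field_simp
    ring
  rw [h4] at h1
  have : (N : ℝ) ^ n * (1 / 2) ≤ N ^ n * (1 + -(n / N)) ^ n :=
    mul_le_mul_of_nonneg_left (by linarith) (by positivity)
  linarith

theorem mul_descFactorial_sq_le {l : ℕ} (hl : 4 ≤ l) :
    (32 : ℝ) * (l ^ 2).descFactorial (4 * l) ≤ ((l : ℝ) ^ 2) ^ (4 * l) := by
  have hl2 : 2 * l ≤ l ^ 2 := by nlinarith
  have h1 : (l ^ 2).descFactorial (4 * l) ≤ (l ^ 2 - 2 * l) ^ (2 * l) * (l ^ 2) ^ (2 * l) := by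
    rw [← Nat.descFactorial_mul_descFactorial (by omega : 2 * l ≤ 4 * l),
      (by omega : 4 * l - 2 * l = 2 * l)]
    exact Nat.mul_le_mul (Nat.descFactorial_le_pow _ _) (Nat.descFactorial_le_pow _ _)
  have h1' : ((l ^ 2).descFactorial (4 * l) : ℝ) ≤
      ((l : ℝ) ^ 2 - 2 * l) ^ (2 * l) * ((l : ℝ) ^ 2) ^ (2 * l) := by
    have := (Nat.cast_le (α := ℝ)).2 h1
    push_cast [Nat.cast_sub hl2] at this
    exact this
  have hl0 : (4 : ℝ) ≤ l := by exact_mod_cast hl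
  have h2 : (1 - 2 / (l : ℝ)) ^ (2 * l) ≤ 1 / 32 := by
    have h0 : 0 ≤ 1 - 2 / (l : ℝ) := by
      rw [sub_nonneg, div_le_one (by linarith)]
      linarith
    calc (1 - 2 / (l : ℝ)) ^ (2 * l) ≤ Real.exp (-(2 / l)) ^ (2 * l) := by
          gcongr
          linarith [Real.add_one_le_exp (-(2 / (l : ℝ)))]
      _ = Real.exp (-4) := by
          rw [← Real.exp_nat_mul]
          congr 1
          push_cast
          field_simp
          norm_num
      _ ≤ 1 / 32 := by
          rw [Real.exp_neg, inv_eq_one_div]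
          apply one_div_le_one_div_of_le (by norm_num)
          have h27 : (2.7 : ℝ) ≤ Real.exp 1 := by linarith [Real.exp_one_gt_d9]
          calc (32 : ℝ) ≤ 2.7 ^ 4 := by norm_num
            _ ≤ Real.exp 1 ^ 4 := by gcongr
            _ = Real.exp 4 := by rw [← Real.exp_nat_mul]; norm_num
  have h3 : ((l : ℝ) ^ 2 - 2 * l) = l ^ 2 * (1 - 2 / l) := by field_simp
  rw [h3, mul_pow] at h1'
  have h4 : ((l : ℝ) ^ 2) ^ (4 * l) = ((l : ℝ) ^ 2) ^ (2 * l) * ((l : ℝ) ^ 2) ^ (2 * l) := by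
    rw [← pow_add]; congr 1; omega
  rw [h4]
  have h5 : (0 : ℝ) ≤ ((l : ℝ) ^ 2) ^ (2 * l) * ((l : ℝ) ^ 2) ^ (2 * l) := by positivity
  nlinarith [mul_le_mul_of_nonneg_left h2 h5]

theorem sq_mul_card_collision {L m : ℕ} {i j : Fin L} (hij : i ≠ j) (B : Finset (Fin m)) :
    m ^ 2 * #{x : Fin L → Fin m | x i = x j ∧ x i ∈ B} ≤ #B * m ^ L := by
  have key : #(({x : Fin L → Fin m | x i = x j ∧ x i ∈ B} : Finset (Fin L → Fin m)) ×ˢ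
      (univ : Finset (Fin m × Fin m))) ≤ #(B ×ˢ (univ : Finset (Fin L → Fin m))) := by
    refine card_le_card_of_injOn
      (fun p => (p.1 i, Function.update (Function.update p.1 i p.2.1) j p.2.2)) ?_ ?_
    · intro p hp
      simp at hp ⊢
      exact hp.2
    · rintro ⟨x, u, v⟩ hp ⟨y, u', v'⟩ hq h
      simp only [coe_product, coe_filter, mem_univ, true_and, coe_univ, Set.mem_prod,
        Set.mem_ofPred_eq, Set.mem_univ, and_true] at hp hq
      simp only [Prod.mk.injEq] at h
      obtain ⟨h1, h2⟩ := h
      have hu := congrFun h2 i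
      have hv := congrFun h2 j
      simp [hij] at hu hv
      subst hu hv
      have hxy : x = y := by
        funext a
        by_cases hai : a = i
        · rw [hai, h1]
        by_cases haj : a = j
        · rw [haj, ← hp.1, ← hq.1, h1]
        have := congrFun h2 a
        simpa [hai, haj] using this
      rw [hxy]
  simp only [card_product, card_univ, Fintype.card_prod, Fintype.card_fin, Fintype.card_fun]
    at key
  nlinarith

/-- Most words of length `4 * l` over an alphabet of size `l ^ 2` repeat a letter outside a given
small set. -/
theorem mul_card_collisions_subset_le {l : ℕ} (hl : 4 ≤ l) (B : Finset (Fin (l ^ 2)))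
    (hB : 512 * #B ≤ l ^ 2) :
    (16 : ℝ) * #{x : Fin (4 * l) → Fin (l ^ 2) | ∀ i j, i ≠ j → x i = x j → x i ∈ B} ≤
      ((l : ℝ) ^ 2) ^ (4 * l) := by
  have hsub : ({x : Fin (4 * l) → Fin (l ^ 2) | ∀ i j, i ≠ j → x i = x j → x i ∈ B} :
        Finset (Fin (4 * l) → Fin (l ^ 2))) ⊆
      ({x : Fin (4 * l) → Fin (l ^ 2) | Function.Injective x} : Finset _) ∪
      (univ : Finset (Fin (4 * l))).offDiag.biUnion fun p =>
        {x : Fin (4 * l) → Fin (l ^ 2) | x p.1 = x p.2 ∧ x p.1 ∈ B} := by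
    intro x hx
    simp only [mem_filter, mem_univ, true_and, mem_union, mem_biUnion, mem_offDiag] at hx ⊢
    by_cases hinj : Function.Injective x
    · exact Or.inl hinj
    · right
      simp only [Function.Injective, not_forall] at hinj
      obtain ⟨i, j, hxij, hij⟩ := hinj
      exact ⟨(i, j), hij, hxij, hx i j hij hxij⟩
  have hinj : #({x : Fin (4 * l) → Fin (l ^ 2) | Function.Injective x}) =
      (l ^ 2).descFactorial (4 * l) := by
    rw [← Fintype.card_subtype,
      Fintype.card_congr (Equiv.subtypeInjectiveEquivEmbedding (Fin (4 * l)) (Fin (l ^ 2))),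
      Fintype.card_embedding_eq, Fintype.card_fin, Fintype.card_fin]
  set X := (l ^ 2) ^ (4 * l) with hX
  have hbi : (l ^ 2) ^ 2 * #((univ : Finset (Fin (4 * l))).offDiag.biUnion fun p =>
        ({x : Fin (4 * l) → Fin (l ^ 2) | x p.1 = x p.2 ∧ x p.1 ∈ B} : Finset _)) ≤
      16 * l ^ 2 * (#B * X) := by
    refine (Nat.mul_le_mul_left _ card_biUnion_le).trans ?_
    rw [mul_sum]
    refine (sum_le_card_nsmul _ _ (#B * X) fun p hp =>
      sq_mul_card_collision (mem_offDiag.1 hp).2.2 B).trans ?_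
    rw [smul_eq_mul]
    refine Nat.mul_le_mul_right _ ?_
    rw [offDiag_card, card_univ, Fintype.card_fin]
    have : 4 * l * (4 * l) = 16 * l ^ 2 := by ring
    omega
  have hcard := (card_le_card hsub).trans (card_union_le _ _)
  rw [hinj] at hcard
  set Y := #((univ : Finset (Fin (4 * l))).offDiag.biUnion fun p =>
        ({x : Fin (4 * l) → Fin (l ^ 2) | x p.1 = x p.2 ∧ x p.1 ∈ B} : Finset _))
  have hY : 32 * Y ≤ X := by
    have hpos : 0 < (l ^ 2) ^ 2 := by positivity
    refine Nat.le_of_mul_le_mul_left ?_ hpos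
    calc (l ^ 2) ^ 2 * (32 * Y) = 32 * ((l ^ 2) ^ 2 * Y) := by ring
      _ ≤ 32 * (16 * l ^ 2 * (#B * X)) := Nat.mul_le_mul_left _ hbi
      _ = l ^ 2 * (512 * #B) * X := by ring
      _ ≤ l ^ 2 * l ^ 2 * X := by gcongr
      _ = (l ^ 2) ^ 2 * X := by ring
  have hdf := mul_descFactorial_sq_le hl
  have hXr : ((l : ℝ) ^ 2) ^ (4 * l) = X := by rw [hX]; push_cast; rfl
  rw [hXr] at hdf ⊢
  have hcr := (Nat.cast_le (α := ℝ)).2 hcard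
  have hYr := (Nat.cast_le (α := ℝ)).2 hY
  push_cast at hcr hYr
  linarith

open Classical in
theorem pow_mul_card_covered_le {T L d m k : ℕ} {q : ℝ} (hq : 1 ≤ q) (A : Finset (Fin T))
    (hA : #A ≤ k) (B : Finset (Fin m))
    (hX : q * #{x : Fin L → Fin m | ∀ i j, i ≠ j → x i = x j → x i ∈ B} ≤ (m : ℝ) ^ L) :
    q ^ (T - k) * #{h : Fin (T * L + d) → Fin m |
      ∀ t ∉ A, ∀ r, RepeatsInBlock h t r → r ∈ B} ≤ (m : ℝ) ^ (T * L + d) := by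
  let C : Finset (Fin L → Fin m) := {x | ∀ i j, i ≠ j → x i = x j → x i ∈ B}
  let F : Fin T → Finset (Fin L → Fin m) := fun t => if t ∈ A then univ else C
  have key : #{h : Fin (T * L + d) → Fin m | ∀ t ∉ A, ∀ r, RepeatsInBlock h t r → r ∈ B} ≤
      #(Fintype.piFinset F ×ˢ (univ : Finset (Fin d → Fin m))) := by
    refine card_le_card_of_injOn
      (fun h => (fun t j => h (blockPos d t j), fun i => h (Fin.natAdd (T * L) i))) ?_ ?_
    · intro h hh
      simp only [coe_filter, mem_univ, true_and, Set.mem_ofPred_eq] at hh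
      simp only [coe_product, coe_univ, Set.mem_prod, Set.mem_univ, and_true, mem_coe,
        Fintype.mem_piFinset]
      intro t
      by_cases ht : t ∈ A
      · simp [F, ht]
      · simp only [F, ht, if_false, C, mem_filter, mem_univ, true_and]
        exact fun i j hij hx => hh t ht _ ⟨i, j, hij, rfl, hx.symm⟩
    · intro g _ h _ hgh
      simp only [Prod.mk.injEq] at hgh
      funext x
      induction x using Fin.addCases with
      | left x =>
        obtain ⟨⟨t, j⟩, rfl⟩ := finProdFinEquiv.surjective x
        exact congrFun (congrFun hgh.1 t) j
      | right x => exact congrFun hgh.2 x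
  have hprod : q ^ (T - k) * (#(Fintype.piFinset F) : ℝ) ≤ (m : ℝ) ^ (T * L) := by
    have h1 : q ^ (T - k) ≤ ∏ t : Fin T, if t ∈ A then 1 else q := by
      rw [prod_ite, prod_const_one, one_mul, prod_const]
      refine pow_le_pow_right₀ hq ?_
      have : ({t | t ∉ A} : Finset (Fin T)) = Aᶜ := by ext; simp
      rw [this, card_compl, Fintype.card_fin]
      omega
    calc q ^ (T - k) * (#(Fintype.piFinset F) : ℝ)
        ≤ (∏ t : Fin T, if t ∈ A then 1 else q) * (#(Fintype.piFinset F) : ℝ) := by gcongr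
      _ = ∏ t : Fin T, (if t ∈ A then 1 else q) * (#(F t) : ℝ) := by
          rw [Fintype.card_piFinset, prod_mul_distrib]
          push_cast
          rfl
      _ ≤ ∏ _t : Fin T, (m : ℝ) ^ L := by
          refine prod_le_prod (fun t _ => ?_) fun t _ => ?_
          · split_ifs <;> positivity
          · by_cases ht : t ∈ A
            · simp [F, ht]
            · simpa only [F, ht, if_false] using hX
      _ = (m : ℝ) ^ (T * L) := by
          rw [prod_const, card_univ, Fintype.card_fin, ← pow_mul, mul_comm]
  have hkey := (Nat.cast_le (α := ℝ)).2 key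
  rw [card_product, card_univ, Fintype.card_fun, Fintype.card_fin, Fintype.card_fin] at hkey
  push_cast at hkey
  calc _ ≤ q ^ (T - k) * ((#(Fintype.piFinset F) : ℝ) * (m : ℝ) ^ d) := by gcongr
    _ = q ^ (T - k) * (#(Fintype.piFinset F) : ℝ) * (m : ℝ) ^ d := by ring
    _ ≤ (m : ℝ) ^ (T * L) * (m : ℝ) ^ d := by gcongr
    _ = _ := (pow_add _ _ _).symm

open Classical in
theorem pow_mul_card_not_hasMatching_le {T L d m k : ℕ} {q : ℝ} (hq : 1 ≤ q)
    (hX : ∀ B : Finset (Fin m), #B ≤ k →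
      q * #{x : Fin L → Fin m | ∀ i j, i ≠ j → x i = x j → x i ∈ B} ≤ (m : ℝ) ^ L) :
    q ^ (T - k) * #{h : Fin (T * L + d) → Fin m |
      ¬ HasMatching (RepeatsInBlock (T := T) (L := L) h) k} ≤
      2 ^ (T + m) * (m : ℝ) ^ (T * L + d) := by
  let I : Finset (Finset (Fin T) × Finset (Fin m)) := {p | #p.1 ≤ k ∧ #p.2 ≤ k}
  let G : Finset (Fin T) × Finset (Fin m) → Finset (Fin (T * L + d) → Fin m) := fun p =>
    {h | ∀ t ∉ p.1, ∀ r, RepeatsInBlock h t r → r ∈ p.2}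
  have hsub : ({h | ¬ HasMatching (RepeatsInBlock (T := T) (L := L) h) k} :
      Finset (Fin (T * L + d) → Fin m)) ⊆ I.biUnion G := by
    intro h hh
    obtain ⟨A, B, hA, hB, hAB⟩ := exists_cover_of_not_hasMatching (mem_filter.1 hh).2
    exact mem_biUnion.2 ⟨(A, B), by simp [I, hA, hB], by simpa [G] using hAB⟩
  have hI : (#I : ℝ) ≤ 2 ^ (T + m) := by
    have : #I ≤ 2 ^ (T + m) := by
      refine (card_le_univ I).trans_eq ?_
      rw [Fintype.card_prod, Fintype.card_finset, Fintype.card_finset, Fintype.card_fin,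
        Fintype.card_fin, pow_add]
    exact_mod_cast this
  have hcard := (Nat.cast_le (α := ℝ)).2 ((card_le_card hsub).trans card_biUnion_le)
  push_cast at hcard
  calc _ ≤ q ^ (T - k) * ∑ p ∈ I, (#(G p) : ℝ) := by gcongr
    _ = ∑ p ∈ I, q ^ (T - k) * (#(G p) : ℝ) := mul_sum _ _ _
    _ ≤ #I • (m : ℝ) ^ (T * L + d) := by
        refine sum_le_card_nsmul _ _ _ fun p hp => ?_
        have hp' := (mem_filter.1 hp).2
        exact pow_mul_card_covered_le hq p.1 hp'.1 p.2 (hX p.2 hp'.2)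
    _ ≤ _ := by
        rw [nsmul_eq_mul]
        gcongr

open Classical in
theorem two_pow_mul_card_not_hasTwins_le {l n : ℕ} (hl : 4 ≤ l) (hn : 4 * l ^ 3 ≤ n) :
    (2 : ℝ) ^ (l ^ 2) * #{π : Equiv.Perm (Fin n) | ¬ HasTwins π (l ^ 2 / 512)} ≤
      2 * n.factorial := by
  obtain ⟨d, rfl⟩ : ∃ d, n = l ^ 2 * (4 * l) + d :=
    ⟨n - 4 * l ^ 3, by rw [(by ring : l ^ 2 * (4 * l) = 4 * l ^ 3)]; omega⟩
  set n := l ^ 2 * (4 * l) + d with hndef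
  set m := l ^ 2 with hm
  set k := m / 512 with hk
  have hmpos : 0 < m := by positivity
  have hnpos : 0 < n := by positivity
  obtain ⟨M, hMpos, hM⟩ : ∃ M, 0 < M ∧ 2 * n ^ 2 ≤ m * M :=
    ⟨2 * n ^ 2, by positivity, Nat.le_mul_of_pos_left _ hmpos⟩
  have h1 := card_perm_mul_descFactorial_le (M := M)
    (fun π : Equiv.Perm (Fin n) => ¬ HasTwins π k)
    (fun h => ¬ HasMatching (RepeatsInBlock (T := m) (L := 4 * l) (m := m) h) k)
    (fun π hπ w hw hmat => hπ (hasTwins_of_hasMatching hw hmat))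
  have h2 := pow_le_two_mul_descFactorial (N := m * M) (n := n) hM
  have h3 := pow_mul_card_not_hasMatching_le (T := m) (L := 4 * l) (d := d) (m := m) (k := k)
    (q := 16) (by norm_num) (fun B hB => by
      have := mul_card_collisions_subset_le hl B (by omega)
      rw [← Nat.cast_pow] at this
      convert this)
  change (16 : ℝ) ^ (m - k) * #{h : Fin n → Fin m |
    ¬ HasMatching (RepeatsInBlock (T := m) (L := 4 * l) h) k} ≤ 2 ^ (m + m) * (m : ℝ) ^ n at h3
  rw [Nat.cast_mul, mul_pow] at h2
  set P : ℝ := (#{π : Equiv.Perm (Fin n) | ¬ HasTwins π k} : ℝ)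
  set Q : ℝ := (#{h : Fin n → Fin m |
    ¬ HasMatching (RepeatsInBlock (T := m) (L := 4 * l) h) k} : ℝ)
  have h1r : P * ((m * M).descFactorial n : ℝ) ≤ n.factorial * (Q * (M : ℝ) ^ n) := by
    simp only [P, Q]
    exact_mod_cast h1
  have hP : 0 ≤ P := Nat.cast_nonneg _
  have hQ : 0 ≤ Q := Nat.cast_nonneg _
  have hMn : (0 : ℝ) < (M : ℝ) ^ n := by positivity
  have hmn : (0 : ℝ) < (m : ℝ) ^ n := by positivity
  have h4 : P * (m : ℝ) ^ n ≤ 2 * n.factorial * Q := by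
    refine le_of_mul_le_mul_right ?_ hMn
    have := mul_le_mul_of_nonneg_left h2 hP
    linarith
  have h5 : (8 : ℝ) ^ m * Q ≤ 4 ^ m * (m : ℝ) ^ n := by
    have h8 : (8 : ℝ) ^ m ≤ 16 ^ (m - k) := by
      rw [(by norm_num : (8 : ℝ) = 2 ^ 3), (by norm_num : (16 : ℝ) = 2 ^ 4), ← pow_mul, ← pow_mul]
      exact pow_le_pow_right₀ (by norm_num) (by omega)
    have h4m : (4 : ℝ) ^ m = 2 ^ (m + m) := by
      rw [← two_mul, pow_mul]; norm_num
    rw [h4m]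
    exact (mul_le_mul_of_nonneg_right h8 hQ).trans h3
  have h48 : (8 : ℝ) ^ m = 2 ^ m * 4 ^ m := by rw [← mul_pow]; norm_num
  have h4pos : (0 : ℝ) < 4 ^ m := by positivity
  refine le_of_mul_le_mul_right ?_ (mul_pos h4pos hmn)
  calc 2 ^ m * P * (4 ^ m * (m : ℝ) ^ n) = 8 ^ m * (P * (m : ℝ) ^ n) := by rw [h48]; ring
    _ ≤ 8 ^ m * (2 * n.factorial * Q) := by gcongr
    _ = 2 * n.factorial * (8 ^ m * Q) := by ring
    _ ≤ 2 * n.factorial * (4 ^ m * (m : ℝ) ^ n) := by gcongr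

theorem mul_rpow_le_div {l n : ℕ} (hl : 32 ≤ l) (hn : n < 4 * (l + 1) ^ 3) :
    (1 / 2 ^ 14 : ℝ) * (n : ℝ) ^ ((2 : ℝ) / 3) ≤ ((l ^ 2 / 512 : ℕ) : ℝ) := by
  have h1 : n ≤ (4 * l) ^ 3 := by
    have : (l + 1) ^ 3 ≤ (2 * l) ^ 3 := Nat.pow_le_pow_left (by omega) 3
    rw [mul_pow] at this ⊢
    omega
  have h2 : (n : ℝ) ^ ((2 : ℝ) / 3) ≤ 16 * (l : ℝ) ^ 2 := by
    calc (n : ℝ) ^ ((2 : ℝ) / 3) ≤ (((4 * l : ℝ)) ^ (3 : ℝ)) ^ ((2 : ℝ) / 3) := by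
          refine Real.rpow_le_rpow (by positivity) ?_ (by norm_num)
          exact_mod_cast h1
      _ = (4 * l : ℝ) ^ (2 : ℝ) := by
          rw [← Real.rpow_mul (by positivity)]
          norm_num
      _ = 16 * (l : ℝ) ^ 2 := by
          rw [Real.rpow_two]
          ring
  have h3 : l ^ 2 ≤ 1024 * (l ^ 2 / 512) := by
    have : 1024 ≤ l ^ 2 := by nlinarith
    omega
  have h3r : (l : ℝ) ^ 2 ≤ 1024 * ((l ^ 2 / 512 : ℕ) : ℝ) := by exact_mod_cast h3
  linarith

/-- The integer part of `(n / 4) ^ (1 / 3)`. -/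
def cubeRootQuarter (n : ℕ) : ℕ := Nat.findGreatest (fun l => 4 * l ^ 3 ≤ n) n

theorem four_mul_cubeRootQuarter_pow_le (n : ℕ) : 4 * cubeRootQuarter n ^ 3 ≤ n :=
  Nat.findGreatest_spec (P := fun l => 4 * l ^ 3 ≤ n) (Nat.zero_le n) (by simp)

theorem le_cubeRootQuarter {l n : ℕ} (h : 4 * l ^ 3 ≤ n) : l ≤ cubeRootQuarter n :=
  Nat.le_findGreatest ((Nat.le_self_pow three_ne_zero l).trans (by omega)) h

theorem lt_four_mul_cubeRootQuarter_succ_pow (n : ℕ) : n < 4 * (cubeRootQuarter n + 1) ^ 3 := by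
  by_contra! h
  have := le_cubeRootQuarter h
  omega

theorem tendsto_cubeRootQuarter : Filter.Tendsto cubeRootQuarter Filter.atTop Filter.atTop :=
  Filter.tendsto_atTop.2 fun l =>
    (Filter.eventually_ge_atTop (4 * l ^ 3)).mono fun _ => le_cubeRootQuarter

open Classical in
theorem one_sub_le_card_div_factorial {l n : ℕ} (hl : 32 ≤ l) (hln : 4 * l ^ 3 ≤ n)
    (hn : n < 4 * (l + 1) ^ 3) :
    1 - 2 * (1 / 2 : ℝ) ^ l ≤ (Nat.card {π : Equiv.Perm (Fin n) //
      (1 / 2 ^ 14 : ℝ) * (n : ℝ) ^ ((2 : ℝ) / 3) ≤ (twinLen π : ℝ)} : ℝ) / n.factorial := by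
  have hf : (0 : ℝ) < n.factorial := by exact_mod_cast n.factorial_pos
  have hcompl := card_filter_add_card_filter_not (s := (univ : Finset (Equiv.Perm (Fin n))))
    (fun π => HasTwins π (l ^ 2 / 512))
  rw [card_univ, Fintype.card_perm, Fintype.card_fin] at hcompl
  have hle : #{π : Equiv.Perm (Fin n) | HasTwins π (l ^ 2 / 512)} ≤
      Nat.card {π : Equiv.Perm (Fin n) //
        (1 / 2 ^ 14 : ℝ) * (n : ℝ) ^ ((2 : ℝ) / 3) ≤ (twinLen π : ℝ)} := by
    rw [Nat.card_eq_fintype_card, Fintype.card_subtype]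
    refine card_le_card (monotone_filter_right _ fun π _ hπ => ?_)
    exact (mul_rpow_le_div hl hn).trans (by exact_mod_cast HasTwins.le_twinLen hπ)
  have hbad := two_pow_mul_card_not_hasTwins_le (by omega) hln
  have hler := (Nat.cast_le (α := ℝ)).2 hle
  have hcomplr := congrArg (Nat.cast : ℕ → ℝ) hcompl
  push_cast at hcomplr
  set b : ℝ := (#{π : Equiv.Perm (Fin n) | ¬ HasTwins π (l ^ 2 / 512)} : ℝ)
  have hb : 0 ≤ b := Nat.cast_nonneg _
  have hbl : b ≤ 2 * (1 / 2) ^ l * n.factorial := by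
    have h2 : (2 : ℝ) ^ l ≤ 2 ^ (l ^ 2) :=
      pow_le_pow_right₀ (by norm_num) (Nat.le_self_pow (by norm_num) l)
    have h3 : (2 : ℝ) ^ l * b ≤ 2 * n.factorial :=
      (mul_le_mul_of_nonneg_right h2 hb).trans hbad
    have h4 : (1 / 2 : ℝ) ^ l * 2 ^ l = 1 := by rw [← mul_pow]; norm_num
    calc b = (1 / 2 : ℝ) ^ l * (2 ^ l * b) := by rw [← mul_assoc, h4, one_mul]
      _ ≤ (1 / 2 : ℝ) ^ l * (2 * n.factorial) := by gcongr
      _ = _ := by ring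
  rw [le_div_iff₀ hf]
  linarith

theorem card_div_factorial_le_one {n : ℕ} (P : Equiv.Perm (Fin n) → Prop) :
    (Nat.card {π // P π} : ℝ) / n.factorial ≤ 1 := by
  refine div_le_one_of_le₀ ?_ (Nat.cast_nonneg _)
  have := Finite.card_subtype_le P
  rw [Nat.card_perm, Nat.card_fin] at this
  exact_mod_cast this

end

/-- There is a constant $c > 0$ such that the proportion of $n$-permutations $π$ with
$t(π) ≥ c·n^{2/3}$ tends to $1$: a.a.s. a random permutation contains twins of length
$Ω(n^{2/3})$ (hence, with the matching upper bound, $t(Π_n) = Θ(n^{2/3})$ a.a.s.). -/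
theorem random_twins_lower :
    ∃ c : ℝ, 0 < c ∧
      Filter.Tendsto (fun n : ℕ =>
          (Nat.card {π : Equiv.Perm (Fin n) //
              c * (n : ℝ) ^ ((2 : ℝ) / 3) ≤ (twinLen π : ℝ)} : ℝ)
            / (Nat.factorial n : ℝ))
        Filter.atTop (nhds 1) := by
  refine ⟨1 / 2 ^ 14, by norm_num, ?_⟩
  have hlim : Filter.Tendsto (fun n => 1 - 2 * (1 / 2 : ℝ) ^ cubeRootQuarter n) Filter.atTop
      (nhds 1) := by
    have := ((tendsto_pow_atTop_nhds_zero_of_lt_one (by norm_num : (0 : ℝ) ≤ 1 / 2)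
      (by norm_num)).comp tendsto_cubeRootQuarter).const_mul 2 |>.const_sub 1
    simpa using this
  refine tendsto_of_tendsto_of_tendsto_of_le_of_le' hlim tendsto_const_nhds ?_
    (Filter.Eventually.of_forall fun n => card_div_factorial_le_one _)
  filter_upwards [tendsto_cubeRootQuarter.eventually_ge_atTop 32] with n hn
  exact one_sub_le_card_div_factorial hn (four_mul_cubeRootQuarter_pow_le n)
    (lt_four_mul_cubeRootQuarter_succ_pow n)
end
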